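/- (Generalized Lax–Friedrichs splitting property for Ω2.) Assume v_min ≥ 0. Let Û = (ρ̂,ŷ,ẑ) and Ǔ = (ρ̌,y̌,ž) be states in Ω2 := {(ρ,y,z) ∈ ℝ³ : ρ > 0, z > 0, v(U) ≥ v_min}. Then for every real α ≥ α_max(Û,Ǔ), the state S_GLF(Û,Ǔ) belongs to Ω2. -/

import Mathlib

noncomputable def press (vref γ κ ρ z : ℝ) : ℝ :=
  if 0 < γ then vref / γ * z ^ κ * ρ ^ (γ - κ) else vref * Real.log ρ

noncomputable def pRho (vref γ κ ρ z : ℝ) : ℝ :=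
  if 0 < γ then vref / γ * (γ - κ) * z ^ κ * ρ ^ (γ - κ - 1) else vref / ρ

noncomputable def pZ (vref γ κ ρ z : ℝ) : ℝ :=
  if 0 < γ then vref / γ * κ * z ^ (κ - 1) * ρ ^ (γ - κ) else 0

noncomputable def vel (vref γ κ : ℝ) (U : ℝ × ℝ × ℝ) : ℝ :=
  U.2.1 / U.1 - press vref γ κ U.1 U.2.2

noncomputable def flux (vref γ κ : ℝ) (U : ℝ × ℝ × ℝ) : ℝ × ℝ × ℝ :=
  vel vref γ κ U • U

noncomputable def sfun (vref γ κ ρ z : ℝ) : ℝ :=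
  ρ ^ 2 * pRho vref γ κ ρ z + ρ * z * pZ vref γ κ ρ z

def dot3 (a b : ℝ × ℝ × ℝ) : ℝ := a.1 * b.1 + a.2.1 * b.2.1 + a.2.2 * b.2.2

noncomputable def nvec (vref γ κ vmin ρ z : ℝ) : ℝ × ℝ × ℝ :=
  (-(vmin + press vref γ κ ρ z + ρ * pRho vref γ κ ρ z), 1, -(ρ * pZ vref γ κ ρ z))

noncomputable def abar (vref γ κ : ℝ) (U : ℝ × ℝ × ℝ) : ℝ :=
  vel vref γ κ U + |U.1 * pRho vref γ κ U.1 U.2.2 + U.2.2 * pZ vref γ κ U.1 U.2.2|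

noncomputable def astd (vref γ κ : ℝ) (Uh Uc : ℝ × ℝ × ℝ) : ℝ :=
  max (abar vref γ κ Uh) (abar vref γ κ Uc)

noncomputable def rho1 (Uh Uc : ℝ × ℝ × ℝ) : ℝ := (Uh.1 + Uc.1) / 2

noncomputable def rho2 (vref γ κ : ℝ) (Uh Uc : ℝ × ℝ × ℝ) : ℝ :=
  rho1 Uh Uc + (Uh.1 * vel vref γ κ Uh - Uc.1 * vel vref γ κ Uc) / (2 * astd vref γ κ Uh Uc)

noncomputable def zet1 (Uh Uc : ℝ × ℝ × ℝ) : ℝ := (Uh.2.2 + Uc.2.2) / 2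

noncomputable def zet2 (vref γ κ : ℝ) (Uh Uc : ℝ × ℝ × ℝ) : ℝ :=
  zet1 Uh Uc + (Uh.2.2 * vel vref γ κ Uh - Uc.2.2 * vel vref γ κ Uc) / (2 * astd vref γ κ Uh Uc)

noncomputable def sbar (vref γ κ : ℝ) (Uh Uc : ℝ × ℝ × ℝ) : ℝ :=
  sSup ((fun q : ℝ × ℝ => sfun vref γ κ q.1 q.2) ''
    (Set.Icc (min (rho1 Uh Uc) (rho2 vref γ κ Uh Uc)) (max (rho1 Uh Uc) (rho2 vref γ κ Uh Uc)) ×ˢ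
     Set.Icc (min (zet1 Uh Uc) (zet2 vref γ κ Uh Uc)) (max (zet1 Uh Uc) (zet2 vref γ κ Uh Uc))))

noncomputable def amax (vref γ κ : ℝ) (Uh Uc : ℝ × ℝ × ℝ) : ℝ :=
  max (astd vref γ κ Uh Uc)
    (max (|vel vref γ κ Uh| + sbar vref γ κ Uh Uc / Uh.1)
         (|vel vref γ κ Uc| + sbar vref γ κ Uh Uc / Uc.1))

noncomputable def SGLF (vref γ κ α : ℝ) (U1 U2 : ℝ × ℝ × ℝ) : ℝ × ℝ × ℝ :=
  (1/2 : ℝ) • (U1 + α⁻¹ • flux vref γ κ U1 + U2 - α⁻¹ • flux vref γ κ U2)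

theorem mul_pRho_add_mul_pZ_of_pos {vref γ κ ρ z : ℝ} (hγ : 0 < γ) (hρ : 0 < ρ) (hz : 0 < z) :
    ρ * pRho vref γ κ ρ z + z * pZ vref γ κ ρ z = vref * z ^ κ * ρ ^ (γ - κ) := by
  simp only [pRho, pZ, if_pos hγ, Real.rpow_sub_one hρ.ne', Real.rpow_sub_one hz.ne']
  field_simp
  ring

theorem mul_pRho_add_mul_pZ_pos {vref γ κ ρ z : ℝ} (hvref : 0 < vref) (hρ : 0 < ρ) (hz : 0 < z) :
    0 < ρ * pRho vref γ κ ρ z + z * pZ vref γ κ ρ z := by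
  by_cases hγ : 0 < γ
  · rw [mul_pRho_add_mul_pZ_of_pos hγ hρ hz]
    positivity
  · simp only [pRho, pZ, if_neg hγ]
    positivity

theorem sfun_eq (vref γ κ ρ z : ℝ) :
    sfun vref γ κ ρ z = ρ * (ρ * pRho vref γ κ ρ z + z * pZ vref γ κ ρ z) := by
  unfold sfun
  ring

theorem sfun_pos {vref γ κ ρ z : ℝ} (hvref : 0 < vref) (hρ : 0 < ρ) (hz : 0 < z) :
    0 < sfun vref γ κ ρ z := by
  rw [sfun_eq]
  exact mul_pos hρ (mul_pRho_add_mul_pZ_pos hvref hρ hz)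

theorem continuousOn_sfun (vref γ κ : ℝ) :
    ContinuousOn (fun q : ℝ × ℝ => sfun vref γ κ q.1 q.2) (Set.Ioi 0 ×ˢ Set.Ioi 0) := by
  rintro ⟨ρ, z⟩ ⟨hρ, hz⟩
  have hρ' : ρ ≠ 0 := (Set.mem_Ioi.mp hρ).ne'
  have hz' : z ≠ 0 := (Set.mem_Ioi.mp hz).ne'
  apply ContinuousAt.continuousWithinAt
  by_cases hγ : 0 < γ
  · simp only [sfun, pRho, pZ, if_pos hγ]
    have h₁ (c : ℝ) : ContinuousAt (fun q : ℝ × ℝ => q.1 ^ c) (ρ, z) :=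
      ContinuousAt.rpow_const continuousAt_fst (Or.inl hρ')
    have h₂ (c : ℝ) : ContinuousAt (fun q : ℝ × ℝ => q.2 ^ c) (ρ, z) :=
      ContinuousAt.rpow_const continuousAt_snd (Or.inl hz')
    exact ((continuousAt_fst.pow 2).mul ((continuousAt_const.mul (h₂ _)).mul (h₁ _))).add
      ((continuousAt_fst.mul continuousAt_snd).mul ((continuousAt_const.mul (h₂ _)).mul (h₁ _)))
  · simp only [sfun, pRho, pZ, if_neg hγ]
    fun_prop (disch := assumption)

/-- Bernoulli-type tangent inequality for the convex function `(x, t) ↦ x ^ a * t ^ (-b)`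
at `(1, 1)`. -/
theorem tangent_le_rpow_mul_rpow_neg {a b x t : ℝ} (hb : 0 ≤ b) (hab : b + 1 ≤ a)
    (hx : 0 < x) (ht : 0 < t) :
    1 + a * (x - 1) - b * (t - 1) ≤ x ^ a * t ^ (-b) := by
  have ha : 0 < a := by linarith
  have h := Real.geom_mean_le_arith_mean3_weighted (w₁ := 1 / a) (w₂ := b / a)
    (w₃ := (a - 1 - b) / a) (p₁ := x ^ a * t ^ (-b)) (p₂ := t) (p₃ := 1) (by positivity)
    (by positivity) (div_nonneg (by linarith) ha.le) (by positivity) ht.le zero_le_one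
    (by field_simp; ring)
  have hl : (x ^ a * t ^ (-b)) ^ (1 / a) * t ^ (b / a) * 1 ^ ((a - 1 - b) / a) = x := by
    rw [Real.one_rpow, mul_one, Real.mul_rpow (by positivity) (by positivity),
      ← Real.rpow_mul hx.le, ← Real.rpow_mul ht.le, mul_assoc, ← Real.rpow_add ht,
      mul_one_div_cancel ha.ne', Real.rpow_one, show -b * (1 / a) + b / a = 0 by ring,
      Real.rpow_zero, mul_one]
  rw [hl] at h
  have h' := mul_le_mul_of_nonneg_left h ha.le
  have hr : a * (1 / a * (x ^ a * t ^ (-b)) + b / a * t + (a - 1 - b) / a * 1)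
      = x ^ a * t ^ (-b) + b * t + (a - 1 - b) := by
    field_simp
  rw [hr] at h'
  linarith

/-- The map `(ρ, z) ↦ ρ * p(ρ, z)` lies above its tangent planes. -/
theorem mul_press_tangent_le {vref γ κ ρ z ρ' z' : ℝ} (hvref : 0 < vref) (hγ : 0 ≤ γ)
    (hκ : γ + 1 ≤ κ) (hρ : 0 < ρ) (hz : 0 < z) (hρ' : 0 < ρ') (hz' : 0 < z') :
    ρ * press vref γ κ ρ z + (press vref γ κ ρ z + ρ * pRho vref γ κ ρ z) * (ρ' - ρ)
      + ρ * pZ vref γ κ ρ z * (z' - z) ≤ ρ' * press vref γ κ ρ' z' := by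
  rcases hγ.lt_or_eq with hγ | rfl
  · have h := tangent_le_rpow_mul_rpow_neg (a := κ) (b := κ - γ - 1) (by linarith) (by linarith)
      (div_pos hz' hz) (div_pos hρ' hρ)
    have hc : 0 < vref / γ * z ^ κ * ρ ^ (γ - κ) * ρ := by positivity
    have h' := mul_le_mul_of_nonneg_left h hc.le
    have hl : vref / γ * z ^ κ * ρ ^ (γ - κ) * ρ *
        ((z' / z) ^ κ * (ρ' / ρ) ^ (-(κ - γ - 1))) = ρ' * press vref γ κ ρ' z' := by
      rw [show -(κ - γ - 1) = γ - κ + 1 by ring, Real.div_rpow hz'.le hz.le,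
        Real.div_rpow hρ'.le hρ.le, Real.rpow_add_one hρ.ne', Real.rpow_add_one hρ'.ne', press,
        if_pos hγ]
      have h₁ := (Real.rpow_pos_of_pos hz κ).ne'
      have h₂ := (Real.rpow_pos_of_pos hρ (γ - κ)).ne'
      field_simp
    rw [hl] at h'
    refine le_of_eq_of_le ?_ h'
    simp only [press, pRho, pZ, if_pos hγ, Real.rpow_sub_one hρ.ne', Real.rpow_sub_one hz.ne']
    field_simp
    ring
  · simp only [press, pRho, pZ, lt_irrefl, if_false]
    have h := mul_le_mul_of_nonneg_left (Real.log_le_sub_one_of_pos (div_pos hρ hρ'))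
      (mul_pos hvref hρ').le
    rw [Real.log_div hρ.ne' hρ'.ne'] at h
    have h₁ : vref * ρ' * (ρ / ρ' - 1) = vref * (ρ - ρ') := by field_simp
    have h₂ : ρ * (vref / ρ) = vref := by field_simp
    rw [h₁] at h
    rw [h₂]
    linarith

theorem vel_lt_abar {vref γ κ : ℝ} {U : ℝ × ℝ × ℝ} (hvref : 0 < vref) (hρ : 0 < U.1)
    (hz : 0 < U.2.2) : vel vref γ κ U < abar vref γ κ U :=
  lt_add_of_pos_right _ (abs_pos.mpr (mul_pRho_add_mul_pZ_pos hvref hρ hz).ne')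

theorem add_mul_inv_mem_uIcc {a d α β : ℝ} (hα : 0 < α) (hαβ : α ≤ β) :
    a + d / (2 * β) ∈ Set.Icc (min a (a + d / (2 * α))) (max a (a + d / (2 * α))) := by
  have hβ : 0 < β := hα.trans_le hαβ
  rcases le_total 0 d with hd | hd
  · have h₁ : 0 ≤ d / (2 * β) := by positivity
    have h₂ : d / (2 * β) ≤ d / (2 * α) := by gcongr
    exact ⟨(min_le_left _ _).trans (by linarith), le_trans (by linarith) (le_max_right _ _)⟩
  · have h₁ : 0 ≤ -d / (2 * β) := div_nonneg (by linarith) (by linarith)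
    have h₂ : -d / (2 * β) ≤ -d / (2 * α) := by
      have : 0 ≤ -d := by linarith
      gcongr
    rw [neg_div] at h₁ h₂
    rw [neg_div] at h₂
    exact ⟨(min_le_right _ _).trans (by linarith), le_trans (by linarith) (le_max_left _ _)⟩

theorem splitting_average_pos {a b u v α : ℝ} (ha : 0 < a) (hb : 0 < b) (hu : 0 ≤ u) (hv : v < α)
    (hα : 0 < α) : 0 < (a + b) / 2 + (a * u - b * v) / (2 * α) := by
  have h : (a + b) / 2 + (a * u - b * v) / (2 * α)
      = (a * α + a * u + b * (α - v)) / (2 * α) := by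
    field_simp
    ring
  have := mul_pos hb (sub_pos.mpr hv)
  rw [h]
  positivity

theorem SGLF_fst (vref γ κ α : ℝ) (U V : ℝ × ℝ × ℝ) :
    (SGLF vref γ κ α U V).1
      = (U.1 + V.1) / 2 + (U.1 * vel vref γ κ U - V.1 * vel vref γ κ V) / (2 * α) := by
  simp only [SGLF, flux, Prod.fst_add, Prod.fst_sub, Prod.smul_fst, smul_eq_mul]
  rw [div_eq_mul_inv _ (2 * α), mul_inv]
  ring

theorem SGLF_snd_fst (vref γ κ α : ℝ) (U V : ℝ × ℝ × ℝ) :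
    (SGLF vref γ κ α U V).2.1
      = (U.2.1 + V.2.1) / 2 + (U.2.1 * vel vref γ κ U - V.2.1 * vel vref γ κ V) / (2 * α) := by
  simp only [SGLF, flux, Prod.fst_add, Prod.fst_sub, Prod.smul_fst, Prod.snd_add, Prod.snd_sub,
    Prod.smul_snd, smul_eq_mul]
  rw [div_eq_mul_inv _ (2 * α), mul_inv]
  ring

theorem SGLF_snd_snd (vref γ κ α : ℝ) (U V : ℝ × ℝ × ℝ) :
    (SGLF vref γ κ α U V).2.2
      = (U.2.2 + V.2.2) / 2 + (U.2.2 * vel vref γ κ U - V.2.2 * vel vref γ κ V) / (2 * α) := by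
  simp only [SGLF, flux, Prod.snd_add, Prod.snd_sub, Prod.smul_snd, smul_eq_mul]
  rw [div_eq_mul_inv _ (2 * α), mul_inv]
  ring

theorem snd_fst_eq_mul_vel_add {vref γ κ : ℝ} {U : ℝ × ℝ × ℝ} (hρ : 0 < U.1) :
    U.2.1 = U.1 * vel vref γ κ U + U.1 * press vref γ κ U.1 U.2.2 := by
  unfold vel
  field_simp
  ring

theorem stmt_9 (vref γ κ vmin : ℝ)
    (hvref : 0 < vref) (hγ : 0 ≤ γ) (hκ : γ + 1 ≤ κ) (hvmin : 0 ≤ vmin)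
    (Uh Uc : ℝ × ℝ × ℝ)
    (hUh : Uh ∈ {U : ℝ × ℝ × ℝ | 0 < U.1 ∧ 0 < U.2.2 ∧ vmin ≤ vel vref γ κ U})
    (hUc : Uc ∈ {U : ℝ × ℝ × ℝ | 0 < U.1 ∧ 0 < U.2.2 ∧ vmin ≤ vel vref γ κ U})
    (α : ℝ) (hα : amax vref γ κ Uh Uc ≤ α) :
    SGLF vref γ κ α Uh Uc ∈
      {U : ℝ × ℝ × ℝ | 0 < U.1 ∧ 0 < U.2.2 ∧ vmin ≤ vel vref γ κ U} := by
  obtain ⟨hρh, hzh, hvh⟩ := hUh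
  obtain ⟨hρc, hzc, hvc⟩ := hUc
  have hvh0 := hvmin.trans hvh
  have hvc0 := hvmin.trans hvc
  have hh_std : vel vref γ κ Uh < astd vref γ κ Uh Uc :=
    (vel_lt_abar hvref hρh hzh).trans_le (le_max_left _ _)
  have hc_std : vel vref γ κ Uc < astd vref γ κ Uh Uc :=
    (vel_lt_abar hvref hρc hzc).trans_le (le_max_right _ _)
  have hstd : 0 < astd vref γ κ Uh Uc := hvh0.trans_lt hh_std
  have hstdα : astd vref γ κ Uh Uc ≤ α := (le_max_left _ _).trans hα
  have hα0 : 0 < α := hstd.trans_le hstdα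
  have hh_sbar : |vel vref γ κ Uh| + sbar vref γ κ Uh Uc / Uh.1 ≤ α :=
    ((le_max_left _ _).trans (le_max_right _ _)).trans hα
  have hρ2 : 0 < rho2 vref γ κ Uh Uc := splitting_average_pos hρh hρc hvh0 hc_std hstd
  have hz2 : 0 < zet2 vref γ κ Uh Uc := splitting_average_pos hzh hzc hvh0 hc_std hstd
  have hρ1 : 0 < rho1 Uh Uc := half_pos (add_pos hρh hρc)
  have hz1 : 0 < zet1 Uh Uc := half_pos (add_pos hzh hzc)
  have hρ : 0 < (SGLF vref γ κ α Uh Uc).1 := by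
    rw [SGLF_fst]
    exact splitting_average_pos hρh hρc hvh0 (hc_std.trans_le hstdα) hα0
  have hz : 0 < (SGLF vref γ κ α Uh Uc).2.2 := by
    rw [SGLF_snd_snd]
    exact splitting_average_pos hzh hzc hvh0 (hc_std.trans_le hstdα) hα0
  have hs : sfun vref γ κ (SGLF vref γ κ α Uh Uc).1 (SGLF vref γ κ α Uh Uc).2.2
      ≤ sbar vref γ κ Uh Uc := by
    refine le_csSup (IsCompact.bddAbove_image (isCompact_Icc.prod isCompact_Icc)
      ((continuousOn_sfun vref γ κ).mono (Set.prod_mono ?_ ?_))) ⟨((SGLF vref γ κ α Uh Uc).1,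
        (SGLF vref γ κ α Uh Uc).2.2), ⟨?_, ?_⟩, rfl⟩
    · exact fun x hx => (lt_min hρ1 hρ2).trans_le hx.1
    · exact fun x hx => (lt_min hz1 hz2).trans_le hx.1
    · rw [SGLF_fst]
      exact add_mul_inv_mem_uIcc hstd hstdα
    · rw [SGLF_snd_snd]
      exact add_mul_inv_mem_uIcc hstd hstdα
  refine ⟨hρ, hz, ?_⟩
  have hs0 := sfun_pos (γ := γ) (κ := κ) hvref hρ hz
  have hth := mul_press_tangent_le hvref hγ hκ hρ hz hρh hzh
  have htc := mul_press_tangent_le hvref hγ hκ hρ hz hρc hzc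
  have hyh := snd_fst_eq_mul_vel_add (vref := vref) (γ := γ) (κ := κ) hρh
  have hyc := snd_fst_eq_mul_vel_add (vref := vref) (γ := γ) (κ := κ) hρc
  have hSρ := SGLF_fst vref γ κ α Uh Uc
  have hSy := SGLF_snd_fst vref γ κ α Uh Uc
  have hSz := SGLF_snd_snd vref γ κ α Uh Uc
  rw [hyh, hyc] at hSy
  rw [abs_of_nonneg hvh0] at hh_sbar
  have hsα : sfun vref γ κ (SGLF vref γ κ α Uh Uc).1 (SGLF vref γ κ α Uh Uc).2.2
      ≤ (α - vel vref γ κ Uh) * Uh.1 :=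
    hs.trans ((div_le_iff₀ hρh).mp (by linarith))
  rw [sfun] at hs0 hsα
  rw [vel, le_sub_iff_add_le, le_div_iff₀ hρ]
  generalize (SGLF vref γ κ α Uh Uc).1 = ρ at *
  generalize (SGLF vref γ κ α Uh Uc).2.1 = y at *
  generalize (SGLF vref γ κ α Uh Uc).2.2 = z at *
  generalize press vref γ κ ρ z = p at *
  generalize pRho vref γ κ ρ z = pρ at *
  generalize pZ vref γ κ ρ z = pz at *
  generalize press vref γ κ Uh.1 Uh.2.2 = ph at *
  generalize press vref γ κ Uc.1 Uc.2.2 = pc at *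
  have hvcα := hc_std.trans_le hstdα
  generalize vel vref γ κ Uh = vh at *
  generalize vel vref γ κ Uc = vc at *
  have hρeq : 2 * α * ρ = (α + vh) * Uh.1 + (α - vc) * Uc.1 := by
    rw [hSρ]; field_simp; ring
  have hzeq : 2 * α * z = (α + vh) * Uh.2.2 + (α - vc) * Uc.2.2 := by
    rw [hSz]; field_simp; ring
  have hyeq : 2 * α * y
      = (α + vh) * (Uh.1 * vh + Uh.1 * ph) + (α - vc) * (Uc.1 * vc + Uc.1 * pc) := by
    rw [hSy]; field_simp; ring
  have h₁ := mul_le_mul_of_nonneg_left hth (by linarith : 0 ≤ α + vh)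
  have h₂ := mul_le_mul_of_nonneg_left htc (by linarith : 0 ≤ α - vc)
  have hconv : (vc - vh) * (ρ ^ 2 * pρ + ρ * z * pz) + 2 * α * (ρ * p)
      ≤ (α + vh) * (Uh.1 * ph) + (α - vc) * (Uc.1 * pc) := by
    linear_combination h₁ + h₂ + (p + ρ * pρ) * hρeq + ρ * pz * hzeq
  have hdiff : 0 ≤ (α + vh) * Uh.1 * (vh - vmin) + (α - vc) * Uc.1 * (vc - vmin)
      + (vc - vh) * (ρ ^ 2 * pρ + ρ * z * pz) := by
    have hc_nonneg : 0 ≤ (α - vc) * Uc.1 * (vc - vmin) :=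
      mul_nonneg (mul_nonneg (by linarith) hρc.le) (by linarith)
    have hsα' : ρ ^ 2 * pρ + ρ * z * pz ≤ (α + vh) * Uh.1 :=
      hsα.trans (mul_le_mul_of_nonneg_right (by linarith) hρh.le)
    have hh_nonneg : 0 ≤ (α + vh) * Uh.1 := mul_nonneg (by linarith) hρh.le
    rcases le_total vh vc with hle | hle
    · have h₃ := mul_nonneg hh_nonneg (by linarith : 0 ≤ vh - vmin)
      have h₄ := mul_nonneg (sub_nonneg.mpr hle) hs0.le
      linarith
    · have h₃ := mul_le_mul_of_nonneg_left hsα' (sub_nonneg.mpr hle)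
      have h₄ := mul_nonneg hh_nonneg (sub_nonneg.mpr hvc)
      linarith
  refine le_of_mul_le_mul_left ?_ (by linarith : 0 < 2 * α)
  linear_combination hconv + hdiff - hyeq + vmin * hρeq
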